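/- Let Ω ⊂ ℝ² be a compact convex set with 0 in its interior, Ω° its polar, P and Q area parametrizations of ∂Ω and ∂Ω° respectively, and C : ℝ → ℝ a nondecreasing map with ⟨P(C(s)), Q(s)⟩ = 1 for every s; assume Q is differentiable everywhere with Q′(s) = (−P₂(C(s)), P₁(C(s))). Fix ψ ∈ ℝ and a nonzero constant k ∈ ℝ, and define h(t) := 1 − ⟨Q(ψ), P(C(ψ+kt))⟩ (in the paper's notation h(t) = 1 − sin_{Ω°}(ψ)sin_Ω((ψ+kt)_∘) − cos_{Ω°}(ψ)cos_Ω((ψ+kt)_∘)). Then there exists δ > 0 such that h is non-decreasing on [0,δ] and non-increasing on [−δ,0]. -/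

import Mathlib

open MeasureTheory

/-- The Euclidean pairing on `ℝ × ℝ`. -/
def dot2 (p q : ℝ × ℝ) : ℝ := p.1 * q.1 + p.2 * q.2

/-- The polar set of a subset of `ℝ²`. -/
def polar2 (K : Set (ℝ × ℝ)) : Set (ℝ × ℝ) := {q | ∀ x ∈ K, dot2 q x ≤ 1}

/-- An area parametrization of the boundary of `K`: a locally Lipschitz curve tracing
`frontier K` which sweeps area at unit rate, i.e. `R₁ R₂′ − R₂ R₁′ = 1` a.e.
(equivalently `R θ = (cos_K θ, sin_K θ)` in the paper's convex trigonometry). -/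
structure IsAreaParam (K : Set (ℝ × ℝ)) (R : ℝ → ℝ × ℝ) : Prop where
  lipschitz : LocallyLipschitz R
  mem_frontier : ∀ θ, R θ ∈ frontier K
  area : ∀ᵐ θ : ℝ ∂volume, ∃ v : ℝ × ℝ, HasDerivAt R v θ ∧ (R θ).1 * v.2 - (R θ).2 * v.1 = 1

/-- The planar cross product on `ℝ × ℝ`. -/
def cross2 (p q : ℝ × ℝ) : ℝ := p.1 * q.2 - p.2 * q.1

theorem isClosed_polar2 (K : Set (ℝ × ℝ)) : IsClosed (polar2 K) := by
  have h : polar2 K = ⋂ x ∈ K, {q | dot2 q x ≤ 1} := by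
    ext q
    simp [polar2]
  rw [h]
  refine isClosed_biInter fun x _ => isClosed_le ?_ continuous_const
  unfold dot2
  fun_prop

theorem IsAreaParam.mem {K : Set (ℝ × ℝ)} {R : ℝ → ℝ × ℝ} (hR : IsAreaParam K R)
    (hK : IsClosed K) (θ : ℝ) : R θ ∈ K :=
  hK.frontier_subset (hR.mem_frontier θ)

theorem dot2_le_two_mul_norm (p q : ℝ × ℝ) : dot2 p q ≤ 2 * (‖p‖ * ‖q‖) := by
  have h1 : p.1 * q.1 ≤ ‖p‖ * ‖q‖ :=
    (le_abs_self _).trans (abs_mul p.1 q.1 ▸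
      mul_le_mul (norm_fst_le p) (norm_fst_le q) (abs_nonneg _) (norm_nonneg _))
  have h2 : p.2 * q.2 ≤ ‖p‖ * ‖q‖ :=
    (le_abs_self _).trans (abs_mul p.2 q.2 ▸
      mul_le_mul (norm_snd_le p) (norm_snd_le q) (abs_nonneg _) (norm_nonneg _))
  unfold dot2
  linarith

/-- If `Q′` is the quarter turn of a bounded curve `p` with `⟨Q, p⟩ = 1`, then `Q` turns
strictly counterclockwise near every point. -/
theorem exists_cross2_pos {Q p : ℝ → ℝ × ℝ} {M : ℝ} (hM : ∀ s, ‖p s‖ ≤ M)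
    (hQp : ∀ s, dot2 (Q s) (p s) = 1)
    (hQ' : ∀ s, HasDerivAt Q (-(p s).2, (p s).1) s) (ψ : ℝ) :
    ∃ η > 0, ∀ s t, |s - ψ| ≤ η → |t - ψ| ≤ η → s < t → 0 < cross2 (Q s) (Q t) := by
  have hM0 : 0 ≤ M := (norm_nonneg _).trans (hM 0)
  obtain ⟨η, hη, hclose⟩ := Metric.continuousAt_iff.1 (hQ' ψ).continuousAt
    (1 / (4 * (M + 1))) (by positivity)
  refine ⟨η / 2, by positivity, fun s t hs ht hst => ?_⟩
  have hderiv (x : ℝ) : HasDerivAt (fun u => cross2 (Q s) (Q u)) (dot2 (Q s) (p x)) x := by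
    have h1 : HasDerivAt (fun u => (Q u).1) (-(p x).2) x := (hQ' x).fst
    have h2 : HasDerivAt (fun u => (Q u).2) (p x).1 x := (hQ' x).snd
    refine ((h2.const_mul (Q s).1).sub (h1.const_mul (Q s).2)).congr_deriv ?_
    simp only [dot2]
    ring
  obtain ⟨c, hc, hslope⟩ := exists_hasDerivAt_eq_slope (fun u => cross2 (Q s) (Q u)) _ hst
    (fun x _ => (hderiv x).continuousAt.continuousWithinAt) (fun x _ => hderiv x)
  have hcψ : |c - ψ| ≤ η / 2 := by
    rw [abs_le] at hs ht ⊢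
    constructor <;> linarith [hc.1, hc.2]
  have hsQ : dist (Q s) (Q ψ) < 1 / (4 * (M + 1)) :=
    hclose (by rw [Real.dist_eq]; linarith)
  have hcQ : dist (Q c) (Q ψ) < 1 / (4 * (M + 1)) :=
    hclose (by rw [Real.dist_eq]; linarith)
  have hnorm : ‖Q c - Q s‖ ≤ 1 / (2 * (M + 1)) := by
    rw [← dist_eq_norm]
    have : 1 / (4 * (M + 1)) + 1 / (4 * (M + 1)) = 1 / (2 * (M + 1)) := by
      field_simp
      norm_num
    linarith [dist_triangle_right (Q c) (Q s) (Q ψ)]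
  have hpos : 0 < dot2 (Q s) (p c) := by
    have hsplit : dot2 (Q s) (p c) = 1 - dot2 (Q c - Q s) (p c) := by
      rw [← hQp c]
      simp only [dot2, Prod.fst_sub, Prod.snd_sub]
      ring
    have hprod : ‖Q c - Q s‖ * ‖p c‖ ≤ 1 / (2 * (M + 1)) * M :=
      mul_le_mul hnorm (hM c) (norm_nonneg _) (by positivity)
    have hlt : 1 / (2 * (M + 1)) * M < 1 / 2 := by
      rw [one_div_mul_eq_div, div_lt_div_iff₀ (by positivity) (by norm_num)]
      linarith
    linarith [dot2_le_two_mul_norm (Q c - Q s) (p c)]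
  have hself : cross2 (Q s) (Q s) = 0 := by
    unfold cross2
    ring
  rw [hslope, hself, sub_zero] at hpos
  exact (div_pos_iff_of_pos_right (sub_pos.2 hst)).1 hpos

/-- Under polar duality, `⟨Q ψ, p⟩` decreases as the parameter moves away from `ψ`. -/
theorem exists_monotoneOn_antitoneOn_dot2 {Q p : ℝ → ℝ × ℝ} {M : ℝ} (hM : ∀ s, ‖p s‖ ≤ M)
    (hle : ∀ s t, dot2 (Q s) (p t) ≤ 1) (hQp : ∀ s, dot2 (Q s) (p s) = 1)
    (hQ' : ∀ s, HasDerivAt Q (-(p s).2, (p s).1) s) (ψ : ℝ) :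
    ∃ η > 0, MonotoneOn (fun s => dot2 (Q ψ) (p s)) (Set.Icc (ψ - η) ψ) ∧
      AntitoneOn (fun s => dot2 (Q ψ) (p s)) (Set.Icc ψ (ψ + η)) := by
  obtain ⟨η, hη, hcross⟩ := exists_cross2_pos hM hQp hQ' ψ
  have hψ : |ψ - ψ| ≤ η := by simpa using hη.le
  have hnonneg (s t : ℝ) (hs : |s - ψ| ≤ η) (ht : |t - ψ| ≤ η) (hst : s ≤ t) :
      0 ≤ cross2 (Q s) (Q t) := by
    rcases hst.eq_or_lt with rfl | hst
    · unfold cross2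
      linarith
    · exact (hcross s t hs ht hst).le
  have hid (s t : ℝ) : cross2 (Q s) (Q t) * (dot2 (Q ψ) (p t) - dot2 (Q ψ) (p s)) =
      cross2 (Q s) (Q ψ) * (1 - dot2 (Q t) (p s)) -
        cross2 (Q ψ) (Q t) * (1 - dot2 (Q s) (p t)) := by
    have hs := hQp s
    have ht := hQp t
    simp only [cross2, dot2] at hs ht ⊢
    linear_combination ((Q s).1 * (Q ψ).2 - (Q s).2 * (Q ψ).1) * ht -
      ((Q ψ).1 * (Q t).2 - (Q ψ).2 * (Q t).1) * hs
  have hanti (s t : ℝ) : cross2 (Q s) (Q t) = -cross2 (Q t) (Q s) := by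
    unfold cross2
    ring
  refine ⟨η, hη, fun s hs t ht hst => ?_, fun s hs t ht hst => ?_⟩ <;>
    rcases hst.eq_or_lt with rfl | hlt
  · exact le_rfl
  · have hsη : |s - ψ| ≤ η := abs_le.2 ⟨by linarith [hs.1], by linarith [hs.2]⟩
    have htη : |t - ψ| ≤ η := abs_le.2 ⟨by linarith [ht.1], by linarith [ht.2]⟩
    refine sub_nonneg.1 (nonneg_of_mul_nonneg_right ?_ (hcross s t hsη htη hlt))
    rw [hid, hanti ψ t]
    have h1 := mul_nonneg (hnonneg s ψ hsη hψ hs.2) (sub_nonneg.2 (hle t s))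
    have h2 := mul_nonneg (hnonneg t ψ htη hψ ht.2) (sub_nonneg.2 (hle s t))
    linarith
  · exact le_rfl
  · have hsη : |s - ψ| ≤ η := abs_le.2 ⟨by linarith [hs.1], by linarith [hs.2]⟩
    have htη : |t - ψ| ≤ η := abs_le.2 ⟨by linarith [ht.1], by linarith [ht.2]⟩
    refine sub_nonneg.1 (nonneg_of_mul_nonneg_right ?_ (hcross s t hsη htη hlt))
    rw [← neg_sub, mul_neg, hid, hanti s ψ]
    have h1 := mul_nonneg (hnonneg ψ s hψ hsη hs.1) (sub_nonneg.2 (hle t s))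
    have h2 := mul_nonneg (hnonneg ψ t hψ htη ht.1) (sub_nonneg.2 (hle s t))
    linarith

/-- Local monotonicity of
`h(t) = 1 − sin_{Ω°}(ψ)sin_Ω((ψ+kt)_∘) − cos_{Ω°}(ψ)cos_Ω((ψ+kt)_∘)`
around `t = 0`: it is non-decreasing for positive times and non-increasing for
negative times. -/
theorem h_local_monotonicity
    (Ω : Set (ℝ × ℝ)) (hΩc : IsCompact Ω) (hΩconv : Convex ℝ Ω)
    (hΩ0 : ((0, 0) : ℝ × ℝ) ∈ interior Ω)
    (P : ℝ → ℝ × ℝ) (hP : IsAreaParam Ω P)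
    (Q : ℝ → ℝ × ℝ) (hQ : IsAreaParam (polar2 Ω) Q)
    (C : ℝ → ℝ) (hCmono : Monotone C)
    (hCorr : ∀ s, dot2 (P (C s)) (Q s) = 1)
    (hQ' : ∀ s, HasDerivAt Q (-(P (C s)).2, (P (C s)).1) s)
    (ψ k : ℝ) (hk : k ≠ 0) :
    ∃ δ > (0:ℝ),
      MonotoneOn (fun t => 1 - dot2 (Q ψ) (P (C (ψ + k * t)))) (Set.Icc 0 δ) ∧
      AntitoneOn (fun t => 1 - dot2 (Q ψ) (P (C (ψ + k * t)))) (Set.Icc (-δ) 0) := by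
  obtain ⟨M, hM⟩ := hΩc.isBounded.exists_norm_le
  have hmem (s : ℝ) : P (C s) ∈ Ω := hP.mem hΩc.isClosed (C s)
  obtain ⟨η, hη, hmono, hanti⟩ := exists_monotoneOn_antitoneOn_dot2 (p := fun s => P (C s))
    (fun s => hM _ (hmem s)) (fun s t => hQ.mem (isClosed_polar2 Ω) s _ (hmem t))
    (fun s => by rw [← hCorr s]; simp only [dot2]; ring) hQ' ψ
  have hscale (t : ℝ) (ht : |t| ≤ η / |k|) : |k * t| ≤ η := by
    rw [abs_mul, mul_comm]
    exact (le_div_iff₀ (abs_pos.2 hk)).1 ht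
  refine ⟨η / |k|, div_pos hη (abs_pos.2 hk), fun s hs t ht hst => ?_, fun s hs t ht hst => ?_⟩
  · have hsη := abs_le.1 (hscale s (abs_le.2 ⟨by linarith [hs.1, hs.2], hs.2⟩))
    have htη := abs_le.1 (hscale t (abs_le.2 ⟨by linarith [ht.1, ht.2], ht.2⟩))
    refine sub_le_sub_left ?_ 1
    rcases lt_or_gt_of_ne hk with hk | hk
    · have hs0 := mul_nonpos_of_nonpos_of_nonneg hk.le hs.1
      have ht0 := mul_nonpos_of_nonpos_of_nonneg hk.le ht.1
      have hkst := mul_le_mul_of_nonpos_left hst hk.le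
      exact hmono ⟨by linarith, by linarith⟩ ⟨by linarith, by linarith⟩ (by linarith)
    · have hs0 := mul_nonneg hk.le hs.1
      have ht0 := mul_nonneg hk.le ht.1
      have hkst := mul_le_mul_of_nonneg_left hst hk.le
      exact hanti ⟨by linarith, by linarith⟩ ⟨by linarith, by linarith⟩ (by linarith)
  · have hsη := abs_le.1 (hscale s (abs_le.2 ⟨hs.1, by linarith [hs.1, hs.2]⟩))
    have htη := abs_le.1 (hscale t (abs_le.2 ⟨ht.1, by linarith [ht.1, ht.2]⟩))
    refine sub_le_sub_left ?_ 1
    rcases lt_or_gt_of_ne hk with hk | hk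
    · have hs0 := mul_nonneg_of_nonpos_of_nonpos hk.le hs.2
      have ht0 := mul_nonneg_of_nonpos_of_nonpos hk.le ht.2
      have hkst := mul_le_mul_of_nonpos_left hst hk.le
      exact hanti ⟨by linarith, by linarith⟩ ⟨by linarith, by linarith⟩ (by linarith)
    · have hs0 := mul_nonpos_of_nonneg_of_nonpos hk.le hs.2
      have ht0 := mul_nonpos_of_nonneg_of_nonpos hk.le ht.2
      have hkst := mul_le_mul_of_nonneg_left hst hk.le
      exact hmono ⟨by linarith, by linarith⟩ ⟨by linarith, by linarith⟩ (by linarith)
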